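/- Let n ≥ 2, 1 < p < ∞, 0 < q ≤ ∞, and set r = min(q,1). There exists a constant C > 0 such that for every Schwartz function f ∈ 𝒮(ℝⁿ), ‖Tr f‖_{B^{0}_{p,q}(ℝ^{n−1})} ≤ C ( Σ_{k≥0} [ (1+k) 2^{kr/p} a_k(f)^r + 2^{kr/p} b_k(f)^r ] )^{1/r}. -/

import Mathlib

open MeasureTheory FourierTransform
open scoped ENNReal NNReal

noncomputable section

/-- `η` is an admissible bump function: smooth, valued in `[0,1]`, equal to `1` on `|t| ≤ 1`
and vanishing for `|t| ≥ 2`. -/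
def IsBump (η : ℝ → ℝ) : Prop :=
  ContDiff ℝ (⊤ : ℕ∞) η ∧ (∀ t, η t ∈ Set.Icc (0:ℝ) 1) ∧ (∀ t, |t| ≤ 1 → η t = 1) ∧
    (∀ t, 2 ≤ |t| → η t = 0)

/-- The Littlewood–Paley pieces: `φ_0(ξ) = η(|ξ|)`,
`φ_j(ξ) = η(2^{-j}|ξ|) - η(2^{-j+1}|ξ|)` for `j ≥ 1`. -/
def littlewood (η : ℝ → ℝ) {d : ℕ} (j : ℕ) (ξ : EuclideanSpace ℝ (Fin d)) : ℝ :=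
  if j = 0 then η ‖ξ‖
  else η ((2:ℝ) ^ (-(j:ℝ)) * ‖ξ‖) - η ((2:ℝ) ^ (-(j:ℝ) + 1) * ‖ξ‖)

/-- The dyadic decomposition operator `Δ_j f = 𝓕⁻¹(φ_j 𝓕 f)`. -/
def dyadicBox (η : ℝ → ℝ) {d : ℕ} (j : ℕ) (f : EuclideanSpace ℝ (Fin d) → ℂ) :
    EuclideanSpace ℝ (Fin d) → ℂ :=
  𝓕⁻ (fun ξ => (littlewood η j ξ : ℂ) * 𝓕 f ξ)

/-- The `ℓ^q` combination of a family of extended nonnegative reals, with the supremum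
modification for `q = ∞`. -/
def lqSum {ι : Type*} (q : ℝ≥0∞) (a : ι → ℝ≥0∞) : ℝ≥0∞ :=
  if q = ∞ then ⨆ i, a i else (∑' i, a i ^ q.toReal) ^ (1 / q.toReal)

/-- The Besov quasi-norm `‖f‖_{B^s_{p,q}(ℝ^d)} = (Σ_j 2^{jsq} ‖Δ_j f‖_p^q)^{1/q}`. -/
def besovNorm (η : ℝ → ℝ) {d : ℕ} (s : ℝ) (p q : ℝ≥0∞)
    (f : EuclideanSpace ℝ (Fin d) → ℂ) : ℝ≥0∞ :=
  lqSum q (fun j : ℕ =>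
    ENNReal.ofReal ((2:ℝ) ^ ((j:ℝ) * s)) * eLpNorm (dyadicBox η j f) p volume)

/-- The logarithmically weighted Besov quasi-norm
`‖f‖_{B̃^s_{p,q}(ℝ^d)} = (Σ_j (1+j) 2^{jsq} ‖Δ_j f‖_p^q)^{1/q}`. -/
def besovNormLog (η : ℝ → ℝ) {d : ℕ} (s : ℝ) (p q : ℝ≥0∞)
    (f : EuclideanSpace ℝ (Fin d) → ℂ) : ℝ≥0∞ :=
  if q = ∞ then
    ⨆ j : ℕ, ENNReal.ofReal ((2:ℝ) ^ ((j:ℝ) * s)) * eLpNorm (dyadicBox η j f) p volume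
  else
    (∑' j : ℕ, (1 + (j:ℝ≥0∞)) *
        (ENNReal.ofReal ((2:ℝ) ^ ((j:ℝ) * s)) *
          eLpNorm (dyadicBox η j f) p volume) ^ q.toReal) ^ (1 / q.toReal)

/-- The trace `(Tr f)(x̄) = f(x̄, 0)` on the hyperplane `x_n = 0`. -/
def traceFn {m : ℕ} (f : EuclideanSpace ℝ (Fin (m+1)) → ℂ)
    (x : EuclideanSpace ℝ (Fin m)) : ℂ :=
  f ((WithLp.equiv 2 (Fin (m+1) → ℝ)).symm
      (Fin.snoc ((WithLp.equiv 2 (Fin m → ℝ)) x) 0))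

/-- The Lizorkin shell `A_0 = [-1,1]ⁿ`, `A_k = {ξ : 2^{k-1} < max_j |ξ_j| ≤ 2^k}` (`k ≥ 1`). -/
def lizorkinShell {m : ℕ} (k : ℕ) : Set (EuclideanSpace ℝ (Fin (m+1))) :=
  if k = 0 then {ξ | ∀ j, |ξ j| ≤ 1}
  else {ξ | (2:ℝ)^(k-1) < ⨆ j, |ξ j| ∧ (⨆ j, |ξ j|) ≤ (2:ℝ)^k}

/-- The part `S_k` of `A_k` adjacent to the `ξ_n`-axis:
`S_0 = A_0`, `S_k = {ξ ∈ A_k : |ξ_m| ≤ 2^{k-1}, 1 ≤ m ≤ n-1}` (`k ≥ 1`). -/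
def lizorkinAxis {m : ℕ} (k : ℕ) : Set (EuclideanSpace ℝ (Fin (m+1))) :=
  if k = 0 then lizorkinShell (m := m) 0
  else {ξ | ξ ∈ lizorkinShell (m := m) k ∧ ∀ i : Fin m, |ξ i.castSucc| ≤ (2:ℝ)^(k-1)}

/-- The frequency cut-off `𝓕⁻¹(χ_E 𝓕 f)`. -/
def cutBox {d : ℕ} (E : Set (EuclideanSpace ℝ (Fin d)))
    (f : EuclideanSpace ℝ (Fin d) → ℂ) : EuclideanSpace ℝ (Fin d) → ℂ :=
  𝓕⁻ (fun ξ => E.indicator (fun _ => (1:ℂ)) ξ * 𝓕 f ξ)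

/-- `a_k(f) = ‖𝓕⁻¹(χ_{S_k} 𝓕 f)‖_{L^p}`. -/
def aCoef {m : ℕ} (p : ℝ≥0∞) (k : ℕ) (f : EuclideanSpace ℝ (Fin (m+1)) → ℂ) : ℝ≥0∞ :=
  eLpNorm (cutBox (lizorkinAxis (m := m) k) f) p volume

/-- `b_k(f) = ‖𝓕⁻¹(χ_{A_k∖S_k} 𝓕 f)‖_{L^p}`. -/
def bCoef {m : ℕ} (p : ℝ≥0∞) (k : ℕ) (f : EuclideanSpace ℝ (Fin (m+1)) → ℂ) : ℝ≥0∞ :=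
  eLpNorm (cutBox (lizorkinShell (m := m) k \ lizorkinAxis (m := m) k) f) p volume



section Kernel
variable {V : Type*} [NormedAddCommGroup V] [InnerProductSpace ℝ V] [FiniteDimensional ℝ V]

lemma bump_contDiff {η : ℝ → ℝ} (hη : IsBump η) {a : ℝ} (ha : 0 < a) :
    ContDiff ℝ (⊤ : ℕ∞) (fun ξ : V => ((η (a * ‖ξ‖) : ℝ) : ℂ)) := by
  refine Complex.ofRealCLM.contDiff.comp (g := fun x : ℝ => (x : ℂ)) ?_
  rw [contDiff_iff_contDiffAt]
  intro x
  by_cases hx : x = 0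
  · subst hx
    have : (fun ξ : V => η (a * ‖ξ‖)) =ᶠ[nhds 0] fun _ => (1 : ℝ) := by
      have h1 : ∀ᶠ ξ : V in nhds 0, a * ‖ξ‖ < 1 := by
        have hc : Continuous fun ξ : V => a * ‖ξ‖ := by fun_prop
        exact (hc.tendsto 0).eventually_lt_const (by simp)
      filter_upwards [h1] with ξ hξ
      apply hη.2.2.1
      rw [abs_of_nonneg (by positivity)]
      exact hξ.le
    exact contDiffAt_const.congr_of_eventuallyEq this
  · exact hη.1.contDiffAt.comp x (contDiffAt_const.mul (contDiffAt_norm ℝ hx))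

lemma bump_hasCompactSupport {η : ℝ → ℝ} (hη : IsBump η) {a : ℝ} (ha : 0 < a) :
    HasCompactSupport (fun ξ : V => ((η (a * ‖ξ‖) : ℝ) : ℂ)) := by
  apply HasCompactSupport.intro (isCompact_closedBall (0 : V) (2 / a))
  intro x hx
  have : 2 / a < ‖x‖ := by simpa using hx
  rw [div_lt_iff₀ ha] at this
  rw [hη.2.2.2 _ (by rw [abs_of_nonneg (by positivity)]; linarith)]
  simp

/-- the Schwartz function `η(a|ξ|)` -/
def bumpS {η : ℝ → ℝ} (hη : IsBump η) (V : Type*) [NormedAddCommGroup V] [InnerProductSpace ℝ V]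
    [FiniteDimensional ℝ V] {a : ℝ} (ha : 0 < a) : SchwartzMap V ℂ :=
  (bump_hasCompactSupport hη ha).toSchwartzMap (bump_contDiff hη ha)

lemma bumpS_apply {η : ℝ → ℝ} (hη : IsBump η) {a : ℝ} (ha : 0 < a) (ξ : V) :
    bumpS hη V ha ξ = ((η (a * ‖ξ‖) : ℝ) : ℂ) := rfl

variable [MeasurableSpace V] [BorelSpace V]

lemma kernel_scale {η : ℝ → ℝ} (hη : IsBump η) {a : ℝ} (ha : 0 < a) (x : V) :
    (𝓕⁻ (bumpS hη V ha : V → ℂ)) x =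
      ((a ^ Module.finrank ℝ V)⁻¹ : ℝ) • (𝓕⁻ (bumpS hη V one_pos : V → ℂ)) (a⁻¹ • x) := by
  rw [Real.fourierInv_eq, Real.fourierInv_eq]
  have := Measure.integral_comp_smul (volume : Measure V)
    (fun v => Real.fourierChar (inner ℝ v (a⁻¹ • x)) • (bumpS hη V one_pos) v) a
  rw [abs_of_pos (by positivity)] at this
  rw [← this]
  congr 1
  ext v
  simp only [bumpS_apply, norm_smul, inner_smul_left, inner_smul_right, Real.norm_eq_abs,
    abs_of_pos ha, one_mul]
  congr 2
  simp [ha.ne']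

lemma kernel_lintegral {η : ℝ → ℝ} (hη : IsBump η) {a : ℝ} (ha : 0 < a) {s : ℝ} (hs : 0 ≤ s) :
    ∫⁻ x : V, ‖(𝓕⁻ (bumpS hη V ha : V → ℂ)) x‖ₑ ^ s =
      ENNReal.ofReal (a ^ ((Module.finrank ℝ V : ℝ) * (1 - s))) *
        ∫⁻ x : V, ‖(𝓕⁻ (bumpS hη V one_pos : V → ℂ)) x‖ₑ ^ s := by
  have hm : Measurable fun x : V => ‖(𝓕⁻ (bumpS hη V one_pos : V → ℂ)) x‖ₑ ^ s := by
    rw [← SchwartzMap.fourierInv_coe]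
    exact ((𝓕⁻ (bumpS hη V one_pos)).continuous.enorm.measurable).pow_const s
  have := lintegral_map (μ := (volume : Measure V)) hm (measurable_const_smul (a⁻¹ : ℝ))
  rw [Measure.map_addHaar_smul _ (inv_ne_zero ha.ne')] at this
  simp only [kernel_scale hη ha, enorm_smul, ENNReal.mul_rpow_of_nonneg _ _ hs]
  rw [lintegral_const_mul' _ _ (by simp [hs]), ← this, lintegral_smul_measure, smul_eq_mul,
    ← mul_assoc]
  congr 1
  rw [Real.enorm_eq_ofReal (by positivity), ENNReal.ofReal_rpow_of_nonneg (by positivity) hs,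
    ← ENNReal.ofReal_mul (by positivity)]
  congr 1
  rw [abs_of_pos (by positivity), inv_pow, inv_inv, mul_sub, Real.rpow_sub ha, mul_one,
    Real.rpow_mul ha.le, Real.rpow_natCast, Real.inv_rpow (by positivity)]
  field_simp

lemma schwartz_lintegral_rpow_ne_top (g : SchwartzMap V ℂ) {s : ℝ} (hs : 0 < s) :
    ∫⁻ x : V, ‖g x‖ₑ ^ s ≠ ⊤ := by
  have h := g.memLp (ENNReal.ofReal s) (volume : Measure V)
  have h2 := lintegral_rpow_enorm_lt_top_of_eLpNorm_lt_top (by simpa using hs) (by simp) h.2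
  rw [ENNReal.toReal_ofReal hs.le] at h2
  exact h2.ne
end Kernel


/-- Euclidean space shorthand -/
abbrev EE (d : ℕ) := EuclideanSpace ℝ (Fin d)

/-- the linear map `(y,t) ↦ (y,t)` -/
def emb (m : ℕ) : (EE m × ℝ) →ₗ[ℝ] EE (m+1) where
  toFun z := (WithLp.equiv 2 (Fin (m+1) → ℝ)).symm (Fin.snoc ((WithLp.equiv 2 (Fin m → ℝ)) z.1) z.2)
  map_add' z w := by
    ext i
    refine Fin.lastCases ?_ (fun i => ?_) i <;> simp
  map_smul' c z := by
    ext i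
    refine Fin.lastCases ?_ (fun i => ?_) i <;> simp

lemma emb_castSucc {m : ℕ} (z : EE m × ℝ) (i : Fin m) : emb m z i.castSucc = z.1 i := by
  simp [emb]
lemma emb_last {m : ℕ} (z : EE m × ℝ) : emb m z (Fin.last m) = z.2 := by
  simp [emb]

lemma traceFn_eq {m : ℕ} (f : EE (m+1) → ℂ) (x : EE m) : traceFn f x = f (emb m (x, 0)) := rfl

/-- projection on the first `m` coordinates -/
def prj (m : ℕ) : EE (m+1) →ₗ[ℝ] EE m where
  toFun ξ := WithLp.toLp 2 (fun i => ξ i.castSucc)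
  map_add' z w := by ext i; simp
  map_smul' c z := by ext i; simp

lemma prj_apply {m : ℕ} (ξ : EE (m+1)) (i : Fin m) : prj m ξ i = ξ i.castSucc := rfl

lemma inner_emb {m : ℕ} (ξ : EE (m+1)) (z : EE m × ℝ) :
    inner ℝ ξ (emb m z) = inner ℝ (prj m ξ) z.1 + ξ (Fin.last m) * z.2 := by
  simp only [PiLp.inner_apply, Fin.sum_univ_castSucc, emb_castSucc, emb_last, prj_apply]
  simp [mul_comm]

lemma emb_continuous (m : ℕ) : Continuous (emb m) := LinearMap.continuous_of_finiteDimensional _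
lemma prj_continuous (m : ℕ) : Continuous (prj m) := LinearMap.continuous_of_finiteDimensional _

lemma emb_measurePreserving (m : ℕ) :
    MeasurePreserving (emb m) (volume : Measure (EE m × ℝ)) volume := by
  have h1 := (volume_preserving_piFinSuccAbove (fun _ : Fin (m+1) => ℝ) (Fin.last m)).symm
  have h2 := PiLp.volume_preserving_toLp (Fin (m+1))
  have h3 := PiLp.volume_preserving_ofLp (Fin m)
  have h4 : MeasurePreserving (Prod.map (@WithLp.ofLp 2 (Fin m → ℝ)) (id : ℝ → ℝ))
     (volume : Measure (EE m × ℝ)) volume := h3.prod (MeasurePreserving.id volume)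
  have h5 : MeasurePreserving Prod.swap (volume : Measure ((Fin m → ℝ) × ℝ)) volume :=
    Measure.measurePreserving_swap
  have h := h2.comp (h1.comp (h5.comp h4))
  suffices hfun : ⇑(emb m) = _ by
    rw [hfun]; exact h
  funext z
  ext i
  refine Fin.lastCases ?_ (fun i => ?_) i
  · rw [emb_last]
    simp [MeasurableEquiv.piFinSuccAbove, Fin.insertNthEquiv]
  · rw [emb_castSucc]
    simp [MeasurableEquiv.piFinSuccAbove, Fin.insertNthEquiv]

lemma norm_emb_zero {m : ℕ} (y : EE m) : ‖emb m (y, 0)‖ = ‖y‖ := by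
  rw [EuclideanSpace.norm_eq, EuclideanSpace.norm_eq, Fin.sum_univ_castSucc]
  simp [emb_castSucc, emb_last]

/-- isometric embedding of the hyperplane -/
def embI (m : ℕ) : EE m →ₗᵢ[ℝ] EE (m+1) where
  toLinearMap := (emb m).comp (LinearMap.inl ℝ (EE m) ℝ)
  norm_map' y := by simpa using norm_emb_zero y

lemma trace_integrable {m : ℕ} (f : SchwartzMap (EE (m+1)) ℂ) :
    Integrable (fun y : EE m => f (emb m (y, 0))) := by
  have := (SchwartzMap.compCLMOfAntilipschitz ℝ (embI m).toContinuousLinearMap.hasTemperateGrowth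
    (embI m).antilipschitz f).integrable (μ := volume)
  exact this

/-- `∫ e(⟨ξ',x⟩) φ(ξ') h(ξ) dξ` -/
def TT {m : ℕ} (φ : EE m → ℂ) (h : EE (m+1) → ℂ) (x : EE m) : ℂ :=
  ∫ ξ, Real.fourierChar (inner ℝ (prj m ξ) x) • (φ (prj m ξ) * h ξ)

lemma char_cont {X : Type*} [TopologicalSpace X] {g : X → ℝ} (hg : Continuous g) :
    Continuous fun x => Real.fourierChar (g x) := Real.continuous_fourierChar.comp hg

lemma claimB {m : ℕ} (φ : SchwartzMap (EE m) ℂ) (f : SchwartzMap (EE (m+1)) ℂ) (x : EE m) :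
    𝓕⁻ (fun ξ => φ ξ * 𝓕 (traceFn f) ξ) x = TT φ (𝓕 (f : EE (m+1) → ℂ)) x := by
  set u : EE m → ℂ := fun y => f (emb m (y, 0)) with hu
  have hui : Integrable u := trace_integrable f
  have hu' : traceFn f = u := rfl
  set g : EE m → ℂ := fun ξ => Real.fourierChar (inner ℝ ξ x) • φ ξ with hg
  have hgc : Continuous g := (char_cont (by fun_prop)).smul φ.continuous
  have hgi : Integrable g := by
    refine (φ.integrable (μ := volume)).mono hgc.aestronglyMeasurable (Filter.Eventually.of_forall fun ξ => ?_)
    simp [g]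
  have hFg : 𝓕 g = fun y => (𝓕 φ : SchwartzMap (EE m) ℂ) (y - x) := by
    funext y
    rw [SchwartzMap.fourier_coe, Real.fourier_eq, Real.fourier_eq]
    congr 1; ext v
    simp only [g, smul_smul, ← AddChar.map_add_eq_mul, inner_sub_right]
    congr 2; ring
  have hFgi : Integrable (𝓕 g) := by
    rw [hFg]
    exact ((𝓕 φ : SchwartzMap (EE m) ℂ).integrable (μ := volume)).comp_sub_right x
  have step1 : 𝓕⁻ (fun ξ => φ ξ * 𝓕 (traceFn f) ξ) x = ∫ y, u y • 𝓕 g y := by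
    rw [Real.fourierInv_eq, hu']
    have := VectorFourier.integral_fourierIntegral_smul_eq_flip (L := innerₗ (EE m))
      (μ := volume) (ν := volume) Real.continuous_fourierChar continuous_inner hui hgi
    rw [flip_innerₗ] at this
    refine Eq.trans ?_ this
    congr 1; ext v
    change _ = 𝓕 u v • g v
    simp only [g, smul_eq_mul, Circle.smul_def]
    ring
  let L : EE (m+1) →ₗ[ℝ] EE m →ₗ[ℝ] ℝ := -((innerₗ (EE m)).comp (prj m))
  have hL : ∀ ξ y, L ξ y = - inner ℝ (prj m ξ) y := fun ξ y => rfl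
  have hLc : Continuous fun p : EE (m+1) × EE m => L p.1 p.2 := by
    simp only [hL]
    have := prj_continuous m
    fun_prop
  have hf : Integrable (𝓕 (f : EE (m+1) → ℂ)) := by
    rw [← SchwartzMap.fourier_coe]; exact SchwartzMap.integrable _
  have hinv : ∀ y, u y = VectorFourier.fourierIntegral Real.fourierChar volume L
      (𝓕 (f : EE (m+1) → ℂ)) y := by
    intro y
    have h1 : f = 𝓕⁻ (𝓕 f) := by simp
    simp only [u]
    conv_lhs => rw [h1]
    rw [SchwartzMap.fourierInv_coe, SchwartzMap.fourier_coe, Real.fourierInv_eq]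
    unfold VectorFourier.fourierIntegral
    congr 1; ext ξ
    simp [hL, inner_emb]
  rw [step1]
  simp only [hinv]
  rw [VectorFourier.integral_fourierIntegral_smul_eq_flip Real.continuous_fourierChar hLc hf hFgi]
  unfold TT
  congr 1; ext ξ
  have : VectorFourier.fourierIntegral Real.fourierChar volume L.flip (𝓕 g) ξ = g (prj m ξ) := by
    rw [← congrFun (hgc.fourierInv_fourier_eq hgi hFgi) (prj m ξ), Real.fourierInv_eq]
    unfold VectorFourier.fourierIntegral
    congr 1; ext y
    simp [hL, real_inner_comm]
  rw [this]
  simp only [g, smul_eq_mul, Circle.smul_def]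
  ring

lemma claimA {m : ℕ} (φ : SchwartzMap (EE m) ℂ) (ψ : SchwartzMap ℝ ℂ) {h : EE (m+1) → ℂ}
    (hh : Integrable h) (hψ : ∀ ξ, h ξ ≠ 0 → ψ (ξ (Fin.last m)) = 1) (x : EE m) :
    TT φ h x = ∫ z : EE m × ℝ, 𝓕⁻ h (emb m (x, 0) - emb m z) *
      (𝓕⁻ (φ : EE m → ℂ) z.1 * 𝓕⁻ (ψ : ℝ → ℂ) z.2) := by
  set g : EE (m+1) → ℂ := fun ξ => Real.fourierChar (inner ℝ (prj m ξ) x) • h ξ with hg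
  have hprj := prj_continuous m
  have hemb := emb_continuous m
  have hcc : Continuous fun ξ : EE (m+1) => Real.fourierChar (inner ℝ (prj m ξ) x) :=
    char_cont (by fun_prop)
  have hgi : Integrable g := by
    refine hh.mono (hcc.aestronglyMeasurable.smul hh.1) (Filter.Eventually.of_forall fun ξ => ?_)
    simp [g]
  let L : EE (m+1) →ₗ[ℝ] (EE m × ℝ) →ₗ[ℝ] ℝ := (innerₗ (EE (m+1))).compl₂ (emb m)
  have hL : ∀ ξ z, L ξ z = inner ℝ ξ (emb m z) := fun ξ y => rfl
  have hLc : Continuous fun p : EE (m+1) × (EE m × ℝ) => L p.1 p.2 := by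
    simp only [hL]
    fun_prop
  have hKi : Integrable (fun z : EE m × ℝ => 𝓕⁻ (φ : EE m → ℂ) z.1 * 𝓕⁻ (ψ : ℝ → ℂ) z.2) := by
    rw [← SchwartzMap.fourierInv_coe, ← SchwartzMap.fourierInv_coe]
    exact (SchwartzMap.integrable _).mul_prod (SchwartzMap.integrable _)
  have key := VectorFourier.integral_fourierIntegral_smul_eq_flip Real.continuous_fourierChar
    hLc hgi hKi
  have hl : ∀ z, VectorFourier.fourierIntegral Real.fourierChar volume L g z =
      𝓕⁻ h (emb m (x, 0) - emb m z) := by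
    intro z
    rw [Real.fourierInv_eq]
    unfold VectorFourier.fourierIntegral
    congr 1; ext ξ
    simp only [g, smul_smul, ← AddChar.map_add_eq_mul, hL, inner_sub_right, inner_emb]
    congr 2; simp; ring
  simp only [hl, smul_eq_mul] at key
  rw [key]
  unfold TT
  congr 1; ext ξ
  have hr : VectorFourier.fourierIntegral Real.fourierChar volume L.flip
      (fun z : EE m × ℝ => 𝓕⁻ (φ : EE m → ℂ) z.1 * 𝓕⁻ (ψ : ℝ → ℂ) z.2) ξ =
      φ (prj m ξ) * ψ (ξ (Fin.last m)) := by
    have e1 : φ (prj m ξ) = 𝓕 (𝓕⁻ (φ : EE m → ℂ)) (prj m ξ) := by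
      rw [← SchwartzMap.fourierInv_coe, ← SchwartzMap.fourier_coe]; simp
    have e2 : ψ (ξ (Fin.last m)) = 𝓕 (𝓕⁻ (ψ : ℝ → ℂ)) (ξ (Fin.last m)) := by
      rw [← SchwartzMap.fourierInv_coe, ← SchwartzMap.fourier_coe]; simp
    rw [e1, e2, Real.fourier_eq, Real.fourier_eq, ← integral_prod_mul]
    unfold VectorFourier.fourierIntegral
    congr 1; ext z
    simp only [LinearMap.flip_apply, hL, inner_emb, neg_add, AddChar.map_add_eq_mul, Circle.smul_def,
      Circle.coe_mul, smul_eq_mul]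
    rw [real_inner_comm]
    simp
    ring
  rw [hr]
  by_cases h0 : h ξ = 0
  · simp [g, h0]
  · rw [hψ ξ h0]
    simp only [g, Circle.smul_def, smul_eq_mul]
    ring


lemma young_aux {m : ℕ} {P P' : ℝ} (hP : P.HolderConjugate P') {K : EE m → ℝ≥0∞}
    {ψ : ℝ → ℝ≥0∞} {G : EE m × ℝ → ℝ≥0∞} (hK : Measurable K) (hψ : Measurable ψ)
    (hG : Measurable G) :
    ∫⁻ x, (∫⁻ z : EE m × ℝ, G (x - z.1, - z.2) * (K z.1 * ψ z.2)) ^ P ≤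
      ((∫⁻ y, K y) * (∫⁻ t, ψ t ^ P') ^ (1/P')) ^ P * ∫⁻ z, G z ^ P := by
  have hP0 := hP.pos
  have hP0' := hP.symm.pos
  have hsum : 1 / P + 1 / P' = 1 := by
    have := hP.inv_add_inv_eq_one; simpa using this
  have inner_bd : ∀ x, (∫⁻ z : EE m × ℝ, G (x - z.1, - z.2) * (K z.1 * ψ z.2)) ^ P ≤
      (∫⁻ z : EE m × ℝ, G (x - z.1, - z.2) ^ P * K z.1) *
        ((∫⁻ y, K y) * ∫⁻ t, ψ t ^ P') ^ (P / P') := by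
    intro x
    have hG' : Measurable fun z : EE m × ℝ => G (x - z.1, - z.2) := hG.comp (by fun_prop)
    have h1 := ENNReal.lintegral_mul_le_Lp_mul_Lq (volume : Measure (EE m × ℝ)) hP
      (f := fun z : EE m × ℝ => G (x - z.1, - z.2) * K z.1 ^ (1/P)) (g := fun z : EE m × ℝ => K z.1 ^ (1/P') * ψ z.2)
      (by fun_prop) (by fun_prop)
    have e1 : ∀ z : EE m × ℝ, G (x - z.1, - z.2) * (K z.1 * ψ z.2) =
      ((fun z : EE m × ℝ => G (x - z.1, - z.2) * K z.1 ^ (1/P)) * (fun z : EE m × ℝ => K z.1 ^ (1/P') * ψ z.2)) z := by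
      intro z
      have : K z.1 = K z.1 ^ (1/P) * K z.1 ^ (1/P') := by
        rw [← ENNReal.rpow_add_of_nonneg _ _ (by positivity) (by positivity), hsum, ENNReal.rpow_one]
      simp only [Pi.mul_apply]
      conv_lhs => rw [this]
      ring
    have e2 : ∫⁻ z : EE m × ℝ, (K z.1 ^ (1/P') * ψ z.2) ^ P' = (∫⁻ y, K y) * ∫⁻ t, ψ t ^ P' := by
      have := lintegral_prod_mul (μ := (volume : Measure (EE m))) (ν := (volume : Measure ℝ))
        hK.aemeasurable (hψ.pow_const P').aemeasurable
      rw [← this]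
      congr 1; ext z
      rw [ENNReal.mul_rpow_of_nonneg _ _ hP0'.le, ← ENNReal.rpow_mul, one_div_mul_cancel hP0'.ne',
        ENNReal.rpow_one]
    have e3 : ∀ z : EE m × ℝ, (G (x - z.1, - z.2) * K z.1 ^ (1/P)) ^ P =
        G (x - z.1, - z.2) ^ P * K z.1 := by
      intro z
      rw [ENNReal.mul_rpow_of_nonneg _ _ hP0.le, ← ENNReal.rpow_mul, one_div_mul_cancel hP0.ne',
        ENNReal.rpow_one]
    simp only [e1]
    refine (ENNReal.rpow_le_rpow h1 hP0.le).trans_eq ?_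
    rw [e2, ENNReal.mul_rpow_of_nonneg _ _ hP0.le, ← ENNReal.rpow_mul, ← ENNReal.rpow_mul,
      one_div_mul_cancel hP0.ne', ENNReal.rpow_one]
    simp only [e3]
    congr 2
    ring
  have hGK : Measurable fun w : EE m × (EE m × ℝ) => G (w.1 - w.2.1, - w.2.2) ^ P * K w.2.1 :=
    ((hG.comp (by fun_prop)).pow_const P).mul (by fun_prop)
  calc _ ≤ ∫⁻ x, (∫⁻ z : EE m × ℝ, G (x - z.1, - z.2) ^ P * K z.1) *
        ((∫⁻ y, K y) * ∫⁻ t, ψ t ^ P') ^ (P / P') := lintegral_mono inner_bd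
    _ = (∫⁻ x, ∫⁻ z : EE m × ℝ, G (x - z.1, - z.2) ^ P * K z.1) *
        ((∫⁻ y, K y) * ∫⁻ t, ψ t ^ P') ^ (P / P') := by
      rw [lintegral_mul_const _ hGK.lintegral_prod_right']
    _ = ((∫⁻ y, K y) * ∫⁻ z, G z ^ P) * ((∫⁻ y, K y) * ∫⁻ t, ψ t ^ P') ^ (P / P') := by
      congr 1
      rw [lintegral_lintegral_swap hGK.aemeasurable]
      have s1 : ∀ z : EE m × ℝ, ∫⁻ x : EE m, G (x - z.1, - z.2) ^ P * K z.1 =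
          K z.1 * ∫⁻ x : EE m, G (x, - z.2) ^ P := by
        intro z
        have hGz : Measurable fun x : EE m => G (x - z.1, - z.2) := hG.comp (by fun_prop)
        rw [lintegral_mul_const _ (hGz.pow_const P), mul_comm]
        congr 1
        exact lintegral_sub_right_eq_self (fun x => G (x, - z.2) ^ P) z.1
      simp only [s1]
      have hA : Measurable fun t : ℝ => ∫⁻ x : EE m, G (x, -t) ^ P := by
        have : Measurable fun w : ℝ × EE m => G (w.2, - w.1) ^ P :=
          (hG.comp (by fun_prop)).pow_const P
        exact this.lintegral_prod_right'
      have := lintegral_prod_mul (μ := (volume : Measure (EE m))) (ν := (volume : Measure ℝ))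
        hK.aemeasurable hA.aemeasurable
      refine this.trans ?_
      congr 1
      have h2 : ∫⁻ t : ℝ, ∫⁻ x : EE m, G (x, -t) ^ P = ∫⁻ t : ℝ, ∫⁻ x : EE m, G (x, t) ^ P :=
        lintegral_neg_eq_self (fun t : ℝ => ∫⁻ x : EE m, G (x, t) ^ P)
      rw [h2]
      exact (lintegral_prod_symm' _ (hG.pow_const P)).symm
    _ = _ := by
      have hPP : 1 + P / P' = P := by
        have := hP.pos; field_simp at hsum ⊢; linarith
      rw [ENNReal.mul_rpow_of_nonneg _ _ (by positivity : 0 ≤ P / P'),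
        ENNReal.mul_rpow_of_nonneg _ _ hP0.le, ← ENNReal.rpow_mul]
      have : (∫⁻ y, K y) ^ P = (∫⁻ y, K y) * (∫⁻ y, K y) ^ (P/P') := by
        conv_rhs => rw [← ENNReal.rpow_one (∫⁻ y, K y), ← ENNReal.rpow_mul]
        rw [one_mul, ← ENNReal.rpow_add_of_nonneg _ _ (by positivity) (by positivity), hPP]
      rw [this, one_div_mul_eq_div]
      ring

lemma fourierInv_cont {m : ℕ} {h : EE m → ℂ} (hh : Integrable h) : Continuous (𝓕⁻ h) := by
  have : 𝓕⁻ h = fun w => 𝓕 h (-w) := by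
    funext w; exact Real.fourierInv_eq_fourier_neg h w
  rw [this]
  exact (VectorFourier.fourierIntegral_continuous Real.continuous_fourierChar
    continuous_inner hh).comp continuous_neg

lemma TT_bound {m : ℕ} {p : ℝ≥0∞} (hp : 1 < p) (hp' : p ≠ ∞) {P' : ℝ}
    (hP : p.toReal.HolderConjugate P')
    (φ : SchwartzMap (EE m) ℂ) (ψ : SchwartzMap ℝ ℂ) {h : EE (m+1) → ℂ}
    (hh : Integrable h) (hψ : ∀ ξ, h ξ ≠ 0 → ψ (ξ (Fin.last m)) = 1) :
    eLpNorm (TT φ h) p volume ≤ (∫⁻ y, ‖𝓕⁻ (φ : EE m → ℂ) y‖ₑ) *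
      (∫⁻ t, ‖𝓕⁻ (ψ : ℝ → ℂ) t‖ₑ ^ P') ^ (1/P') * eLpNorm (𝓕⁻ h) p volume := by
  have hp0 : p ≠ 0 := (zero_lt_one.trans hp).ne'
  rw [eLpNorm_eq_lintegral_rpow_enorm_toReal hp0 hp', eLpNorm_eq_lintegral_rpow_enorm_toReal hp0 hp']
  set P := p.toReal
  have hP0 := hP.pos
  have hc := (fourierInv_cont hh)
  have hK : Measurable fun y => ‖𝓕⁻ (φ : EE m → ℂ) y‖ₑ := by
    rw [← SchwartzMap.fourierInv_coe]; exact (SchwartzMap.continuous _).enorm.measurable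
  have hψm : Measurable fun y => ‖𝓕⁻ (ψ : ℝ → ℂ) y‖ₑ := by
    rw [← SchwartzMap.fourierInv_coe]; exact (SchwartzMap.continuous _).enorm.measurable
  have hGm : Measurable fun y => ‖𝓕⁻ h y‖ₑ := hc.enorm.measurable
  have hG : Measurable fun z : EE m × ℝ => ‖𝓕⁻ h (emb m z)‖ₑ :=
    hGm.comp (emb_continuous m).measurable
  have hmp : ∫⁻ z : EE m × ℝ, ‖𝓕⁻ h (emb m z)‖ₑ ^ P = ∫⁻ y, ‖𝓕⁻ h y‖ₑ ^ P :=
    (emb_measurePreserving m).lintegral_comp (hGm.pow_const P)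
  have hpt : ∀ x, ‖TT φ h x‖ₑ ≤ ∫⁻ z : EE m × ℝ, ‖𝓕⁻ h (emb m (x - z.1, - z.2))‖ₑ *
      (‖𝓕⁻ (φ : EE m → ℂ) z.1‖ₑ * ‖𝓕⁻ (ψ : ℝ → ℂ) z.2‖ₑ) := by
    intro x
    rw [claimA φ ψ hh hψ x]
    refine (enorm_integral_le_lintegral_enorm _).trans_eq ?_
    congr 1; ext z
    have : emb m (x, 0) - emb m z = emb m (x - z.1, - z.2) := by
      rw [← map_sub]; congr 1; ext <;> simp
    rw [enorm_mul, enorm_mul, this]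
  have hy := young_aux hP hK hψm hG
  rw [hmp] at hy
  calc (∫⁻ x, ‖TT φ h x‖ₑ ^ P) ^ (1/P) ≤ (_ ^ P * ∫⁻ y, ‖𝓕⁻ h y‖ₑ ^ P) ^ (1/P) :=
        ENNReal.rpow_le_rpow ((lintegral_mono fun x => ENNReal.rpow_le_rpow (hpt x) hP0.le).trans hy)
          (by positivity)
    _ = _ := by
      rw [ENNReal.mul_rpow_of_nonneg _ _ (by positivity : 0 ≤ 1/P), ← ENNReal.rpow_mul,
        mul_one_div_cancel hP0.ne', ENNReal.rpow_one]


lemma littlewood_kernel {η : ℝ → ℝ} (hη : IsBump η) (m : ℕ) :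
    ∃ C : ℝ≥0∞, C ≠ ∞ ∧ ∀ j : ℕ, ∃ φ : SchwartzMap (EE m) ℂ,
      (∀ ξ, φ ξ = (littlewood η j ξ : ℂ)) ∧ ∫⁻ y, ‖𝓕⁻ (φ : EE m → ℂ) y‖ₑ ≤ C := by
  set I := ∫⁻ x : EE m, ‖(𝓕⁻ (bumpS hη (EE m) one_pos : EE m → ℂ)) x‖ₑ with hI
  have hIt : I ≠ ⊤ := by
    have := schwartz_lintegral_rpow_ne_top (𝓕⁻ (bumpS hη (EE m) one_pos)) one_pos
    rw [SchwartzMap.fourierInv_coe] at this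
    simpa using this
  have hsc : ∀ {a : ℝ} (ha : 0 < a), ∫⁻ x : EE m, ‖(𝓕⁻ (bumpS hη (EE m) ha : EE m → ℂ)) x‖ₑ = I := by
    intro a ha
    have := kernel_lintegral (V := EE m) hη ha zero_le_one
    simpa using this
  refine ⟨I + I, by simp [hIt], fun j => ?_⟩
  by_cases hj : j = 0
  · refine ⟨bumpS hη (EE m) one_pos, fun ξ => ?_, ?_⟩
    · simp [bumpS_apply, littlewood, hj]
    · rw [hsc]; exact le_self_add
  · have h1 : (0:ℝ) < 2 ^ (-(j:ℝ)) := by positivity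
    have h2 : (0:ℝ) < 2 ^ (-(j:ℝ) + 1) := by positivity
    refine ⟨bumpS hη (EE m) h1 - bumpS hη (EE m) h2, fun ξ => ?_, ?_⟩
    · simp [bumpS_apply, littlewood, hj]
    · rw [← SchwartzMap.fourierInv_coe, sub_eq_add_neg, ← neg_one_smul ℂ (bumpS hη (EE m) h2),
        FourierTransform.fourierInv_add, FourierTransform.fourierInv_smul]
      calc _ ≤ ∫⁻ y, (‖𝓕⁻ (bumpS hη (EE m) h1 : EE m → ℂ) y‖ₑ + ‖𝓕⁻ (bumpS hη (EE m) h2 : EE m → ℂ) y‖ₑ) := by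
            apply lintegral_mono
            intro y
            rw [← SchwartzMap.fourierInv_coe, ← SchwartzMap.fourierInv_coe]
            refine (enorm_add_le _ _).trans_eq ?_
            simp
        _ = I + I := by
            rw [lintegral_add_left, hsc, hsc]
            rw [← SchwartzMap.fourierInv_coe]
            exact (SchwartzMap.continuous _).enorm.measurable

lemma psi_kernel {η : ℝ → ℝ} (hη : IsBump η) {P P' : ℝ} (hP : P.HolderConjugate P') :
    ∃ C : ℝ≥0∞, C ≠ ∞ ∧ ∀ k : ℕ, ∃ ψ : SchwartzMap ℝ ℂ,
      (∀ t, |t| ≤ (2:ℝ) ^ k → ψ t = 1) ∧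
      (∫⁻ t, ‖𝓕⁻ (ψ : ℝ → ℂ) t‖ₑ ^ P') ^ (1/P') ≤ C * ENNReal.ofReal ((2:ℝ) ^ ((k:ℝ) / P)) := by
  have h0 := hP.symm.pos
  set I := ∫⁻ x : ℝ, ‖(𝓕⁻ (bumpS hη ℝ one_pos : ℝ → ℂ)) x‖ₑ ^ P' with hI
  have hIt : I ≠ ⊤ := by
    have := schwartz_lintegral_rpow_ne_top (𝓕⁻ (bumpS hη ℝ one_pos)) h0
    rwa [SchwartzMap.fourierInv_coe] at this
  refine ⟨I ^ (1/P'), ENNReal.rpow_ne_top_of_nonneg (by positivity) hIt, fun k => ?_⟩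
  have h1 : (0:ℝ) < 2 ^ (-(k:ℝ)) := by positivity
  refine ⟨bumpS hη ℝ h1, fun t ht => ?_, ?_⟩
  · rw [bumpS_apply, hη.2.2.1]
    · simp
    · rw [abs_of_nonneg (by positivity), Real.rpow_neg (by positivity), Real.rpow_natCast,
        Real.norm_eq_abs, inv_mul_le_iff₀ (by positivity)]
      simpa using ht
  · rw [kernel_lintegral hη h1 h0.le, ENNReal.mul_rpow_of_nonneg _ _ (by positivity), mul_comm]
    gcongr
    rw [ENNReal.ofReal_rpow_of_nonneg (by positivity) (by positivity)]
    apply ENNReal.ofReal_le_ofReal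
    rw [← Real.rpow_mul (by positivity), ← Real.rpow_mul (by positivity)]
    apply le_of_eq
    congr 1
    have := hP.inv_add_inv_eq_one
    have hP0 := hP.pos
    simp
    have h2 : P⁻¹ = 1 - P'⁻¹ := by linarith
    rw [div_eq_mul_inv, h2]
    field_simp
    ring

lemma TT_continuous {m : ℕ} (φ : SchwartzMap (EE m) ℂ) {h : EE (m+1) → ℂ} (hh : Integrable h) :
    Continuous (TT φ h) ∧ ∀ x, Integrable
      fun ξ => Real.fourierChar (inner ℝ (prj m ξ) x) • (φ (prj m ξ) * h ξ) := by
  have hi : Integrable fun ξ => φ (prj m ξ) * h ξ := by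
    obtain ⟨C, hC⟩ := φ.toBoundedContinuousFunction.isBounded_range.exists_norm_le
    refine hh.bdd_mul (c := C) (φ.continuous.comp (prj_continuous m)).aestronglyMeasurable
      (Filter.Eventually.of_forall fun ξ => hC _ ⟨prj m ξ, rfl⟩)
  let L : EE (m+1) →ₗ[ℝ] EE m →ₗ[ℝ] ℝ := -((innerₗ (EE m)).comp (prj m))
  have hL : ∀ ξ y, L ξ y = - inner ℝ (prj m ξ) y := fun ξ y => rfl
  have hLc : Continuous fun p : EE (m+1) × EE m => L p.1 p.2 := by
    simp only [hL]
    have := prj_continuous m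
    fun_prop
  have e : TT φ h = VectorFourier.fourierIntegral Real.fourierChar volume L
      (fun ξ => φ (prj m ξ) * h ξ) := by
    funext x
    unfold TT VectorFourier.fourierIntegral
    simp [hL]
  constructor
  · rw [e]
    exact VectorFourier.fourierIntegral_continuous Real.continuous_fourierChar hLc hi
  · intro x
    have := (VectorFourier.fourierIntegral_convergent_iff Real.continuous_fourierChar hLc x).2 hi
    simpa [hL] using this

lemma bddAbs {d : ℕ} (ξ : EE d) : BddAbove (Set.range fun j => |ξ j|) := Set.finite_range _ |>.bddAbove

lemma iSup_abs_le_iff {m : ℕ} (ξ : EE (m+1)) (c : ℝ) : (⨆ j, |ξ j|) ≤ c ↔ ∀ j, |ξ j| ≤ c :=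
  ciSup_le_iff (bddAbs ξ)

lemma measurable_iSup_abs (m : ℕ) : Measurable fun ξ : EE (m+1) => ⨆ j, |ξ j| := by
  apply Measurable.iSup
  intro j
  have : Continuous fun ξ : EE (m+1) => |ξ j| := by fun_prop
  exact this.measurable

lemma shell_zero {m : ℕ} : lizorkinShell (m := m) 0 = {ξ | (⨆ j, |ξ j|) ≤ 1} := by
  ext ξ; simp [lizorkinShell, iSup_abs_le_iff]

lemma shell_succ {m : ℕ} (k : ℕ) : lizorkinShell (m := m) (k+1) =
    {ξ | (2:ℝ)^k < (⨆ j, |ξ j|) ∧ (⨆ j, |ξ j|) ≤ (2:ℝ)^(k+1)} := by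
  simp [lizorkinShell]

lemma shell_le {m : ℕ} {k : ℕ} {ξ : EE (m+1)} (h : ξ ∈ lizorkinShell (m := m) k) :
    (⨆ j, |ξ j|) ≤ (2:ℝ)^k := by
  cases k with
  | zero => rw [shell_zero] at h; simpa using h
  | succ k => rw [shell_succ] at h; exact h.2

lemma shell_measurable (m k : ℕ) : MeasurableSet (lizorkinShell (m := m) k) := by
  have := measurable_iSup_abs m
  cases k with
  | zero => rw [shell_zero]; exact measurableSet_le this measurable_const
  | succ k =>
    rw [shell_succ]
    exact (measurableSet_lt measurable_const this).inter (measurableSet_le this measurable_const)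

lemma axis_measurable (m k : ℕ) : MeasurableSet (lizorkinAxis (m := m) k) := by
  unfold lizorkinAxis
  split_ifs
  · exact shell_measurable m 0
  · have : {ξ : EE (m+1) | ξ ∈ lizorkinShell (m := m) k ∧ ∀ i : Fin m, |ξ i.castSucc| ≤ (2:ℝ)^(k-1)}
        = lizorkinShell (m := m) k ∩ ⋂ i : Fin m, {ξ | |ξ i.castSucc| ≤ (2:ℝ)^(k-1)} := by
      ext ξ; simp
    rw [this]
    refine (shell_measurable m k).inter (MeasurableSet.iInter fun i => ?_)
    have : Continuous fun ξ : EE (m+1) => |ξ i.castSucc| := by fun_prop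
    exact measurableSet_le this.measurable measurable_const

lemma axis_subset (m k : ℕ) : lizorkinAxis (m := m) k ⊆ lizorkinShell (m := m) k := by
  unfold lizorkinAxis
  split_ifs with h
  · rw [h]
  · exact fun ξ h => h.1

lemma shell_iUnion (m : ℕ) : (⋃ k, lizorkinShell (m := m) k) = Set.univ := by
  rw [Set.eq_univ_iff_forall]
  intro ξ
  rw [Set.mem_iUnion]
  have hex : ∃ k : ℕ, (⨆ j, |ξ j|) ≤ (2:ℝ)^k := by
    obtain ⟨k, hk⟩ := pow_unbounded_of_one_lt (⨆ j, |ξ j|) (one_lt_two : (1:ℝ) < 2)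
    exact ⟨k, hk.le⟩
  classical
  refine ⟨Nat.find hex, ?_⟩
  have h1 := Nat.find_spec hex
  have h2 := fun k => Nat.find_min (H := hex) (m := k)
  rcases hk : Nat.find hex with _ | k
  · rw [hk] at h1; rw [shell_zero]; simpa using h1
  · rw [hk] at h1
    rw [shell_succ]
    exact ⟨not_le.1 (h2 k (by omega)), h1⟩

lemma shell_disjoint (m : ℕ) : Pairwise (Function.onFun Disjoint (lizorkinShell (m := m))) := by
  have key : ∀ i j : ℕ, i < j → Disjoint (lizorkinShell (m := m) i) (lizorkinShell (m := m) j) := by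
    intro i j hij
    rw [Set.disjoint_left]
    intro ξ hi hj
    obtain ⟨j, rfl⟩ : ∃ l, j = l + 1 := ⟨j - 1, by omega⟩
    rw [shell_succ] at hj
    have h1 := shell_le hi
    have h2 : (2:ℝ)^i ≤ 2^j := pow_le_pow_right₀ (by norm_num) (by omega)
    linarith [hj.1]
  intro i j hij
  rcases lt_or_gt_of_ne hij with h | h
  · exact key i j h
  · exact (key j i h).symm

/-- frequency cutoff of the Fourier transform -/
def cutF {m : ℕ} (E : Set (EE (m+1))) (f : EE (m+1) → ℂ) (ξ : EE (m+1)) : ℂ :=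
  E.indicator (fun _ => (1:ℂ)) ξ * 𝓕 f ξ

lemma cutF_integrable {m : ℕ} {E : Set (EE (m+1))} (hE : MeasurableSet E)
    (f : SchwartzMap (EE (m+1)) ℂ) : Integrable (cutF E f) := by
  have hf : Integrable (𝓕 (f : EE (m+1) → ℂ)) := by
    rw [← SchwartzMap.fourier_coe]; exact SchwartzMap.integrable _
  have : cutF E f = E.indicator (𝓕 (f : EE (m+1) → ℂ)) := by
    funext ξ; by_cases h : ξ ∈ E <;> simp [cutF, h]
  rw [this]
  exact hf.indicator hE

lemma TT_hasSum {m : ℕ} (φ : SchwartzMap (EE m) ℂ) (f : SchwartzMap (EE (m+1)) ℂ) (x : EE m) :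
    HasSum (fun k => TT φ (cutF (lizorkinAxis k) f) x +
      TT φ (cutF (lizorkinShell k \ lizorkinAxis k) f) x) (TT φ (𝓕 (f : EE (m+1) → ℂ)) x) := by
  have hf : Integrable (𝓕 (f : EE (m+1) → ℂ)) := by
    rw [← SchwartzMap.fourier_coe]; exact SchwartzMap.integrable _
  have hi := (TT_continuous φ hf).2 x
  have := hasSum_integral_iUnion (shell_measurable m) (shell_disjoint m) (hi.integrableOn)
  rw [shell_iUnion, setIntegral_univ] at this
  refine Eq.subst (motive := fun g => HasSum g _) (funext fun k => Eq.symm ?_) this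
  have hA := axis_measurable m k
  have hB := (shell_measurable m k).diff hA
  rw [← integral_indicator (shell_measurable m k)]
  unfold TT
  rw [← integral_add ((TT_continuous φ (cutF_integrable hA f)).2 x)
    ((TT_continuous φ (cutF_integrable hB f)).2 x)]
  congr 1; ext ξ
  have hs := axis_subset m k
  by_cases h1 : ξ ∈ lizorkinAxis (m := m) k
  · simp [cutF, h1, hs h1]
  · by_cases h2 : ξ ∈ lizorkinShell (m := m) k <;> simp [cutF, h1, h2]

lemma minkowski {m : ℕ} {p : ℝ≥0∞} (hp : 1 ≤ p) {F G : ℕ → EE m → ℂ} {u : EE m → ℂ}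
    (hF : ∀ k, Continuous (F k)) (hG : ∀ k, Continuous (G k))
    (hs : ∀ x, HasSum (fun k => F k x + G k x) (u x)) :
    eLpNorm u p volume ≤ ∑' k, (eLpNorm (F k) p volume + eLpNorm (G k) p volume) := by
  have h1 := Lp.eLpNorm_lim_le_liminf_eLpNorm (p := p) (μ := (volume : Measure (EE m)))
    (f := fun n x => ∑ k ∈ Finset.range n, (F k x + G k x))
    (fun n => (continuous_finsetSum _ fun k _ => (hF k).add (hG k)).aestronglyMeasurable) u
    (Filter.Eventually.of_forall fun x => (hs x).tendsto_sum_nat)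
  refine h1.trans ?_
  refine Filter.liminf_le_of_le (by isBoundedDefault) fun b hb => ?_
  obtain ⟨n, hn⟩ := hb.exists
  refine hn.trans ?_
  have e : (fun x => ∑ k ∈ Finset.range n, (F k x + G k x)) = ∑ k ∈ Finset.range n, (F k + G k) := by
    ext x; simp
  rw [e]
  refine (eLpNorm_sum_le (fun k _ => ((hF k).add (hG k)).aestronglyMeasurable) hp).trans ?_
  refine le_trans (Finset.sum_le_sum fun k _ => eLpNorm_add_le (hF k).aestronglyMeasurable
    (hG k).aestronglyMeasurable hp) (ENNReal.sum_le_tsum _)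


lemma rpow_tsum_le {a : ℕ → ℝ≥0∞} {r : ℝ} (hr : 0 < r) (hr1 : r ≤ 1) :
    (∑' k, a k) ^ r ≤ ∑' k, a k ^ r := by
  have fin : ∀ s : Finset ℕ, (∑ k ∈ s, a k) ^ r ≤ ∑ k ∈ s, a k ^ r := by
    classical
    intro s
    induction s using Finset.induction_on with
    | empty => simp [hr]
    | insert i s hi ih =>
      rw [Finset.sum_insert hi, Finset.sum_insert hi]
      exact (ENNReal.rpow_add_le_add_rpow _ _ hr.le hr1).trans (by gcongr)
  have h : ∑' k, a k ≤ (∑' k, a k ^ r) ^ (1/r) := by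
    rw [ENNReal.tsum_eq_iSup_sum]
    refine iSup_le fun s => ?_
    rw [one_div, ENNReal.le_rpow_inv_iff hr]
    exact (fin s).trans (ENNReal.sum_le_tsum s)
  rwa [one_div, ENNReal.le_rpow_inv_iff hr] at h

lemma lqSum_le {q : ℝ≥0∞} (hq : 0 < q) {r : ℝ} (hr : r = (min q 1).toReal) (a : ℕ → ℝ≥0∞) :
    lqSum q a ≤ (∑' k, a k ^ r) ^ (1/r) := by
  unfold lqSum
  split_ifs with h
  · have : r = 1 := by simp [hr, h]
    subst this
    simp only [ENNReal.rpow_one, div_one]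
    exact iSup_le fun i => ENNReal.le_tsum i
  · rcases le_total q 1 with h1 | h1
    · rw [min_eq_left h1] at hr
      rw [hr]
    · rw [min_eq_right h1] at hr
      simp only [hr, ENNReal.toReal_one, ENNReal.rpow_one, div_one]
      have hq1 : 1 ≤ q.toReal := by
        rw [← ENNReal.toReal_one]; exact ENNReal.toReal_mono h h1
      have hq0 : 0 < q.toReal := by linarith
      refine (rpow_tsum_le (by positivity) (by rw [div_le_one hq0]; exact hq1)).trans_eq ?_
      congr 1; ext k
      rw [← ENNReal.rpow_mul, mul_one_div_cancel hq0.ne', ENNReal.rpow_one]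

lemma littlewood_ne_zero {η : ℝ → ℝ} (hη : IsBump η) {m j : ℕ} {ζ : EE m}
    (h : littlewood η j ζ ≠ 0) : (j = 0 ∨ (2:ℝ)^j < 2 * ‖ζ‖) ∧ ‖ζ‖ < 2^(j+1) := by
  have hn := norm_nonneg ζ
  unfold littlewood at h
  split_ifs at h with hj
  · refine ⟨Or.inl hj, ?_⟩
    by_contra hc
    apply h
    apply hη.2.2.2
    rw [abs_of_nonneg hn]
    simpa [hj] using hc
  · have e1 : (2:ℝ) ^ (-(j:ℝ)) = (2^j)⁻¹ := by
      rw [Real.rpow_neg (by norm_num), Real.rpow_natCast]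
    have e2 : (2:ℝ) ^ (-(j:ℝ) + 1) = (2^j)⁻¹ * 2 := by
      rw [Real.rpow_add (by norm_num), e1, Real.rpow_one]
    rw [e1, e2] at h
    have hpos : (0:ℝ) < 2^j := by positivity
    refine ⟨Or.inr ?_, ?_⟩
    · by_contra hc
      push Not at hc
      apply h
      rw [hη.2.2.1, hη.2.2.1, sub_self]
      · rw [abs_of_nonneg (by positivity), mul_assoc, inv_mul_le_iff₀ hpos]; linarith
      · rw [abs_of_nonneg (by positivity), inv_mul_le_iff₀ hpos]; linarith
    · by_contra hc
      push Not at hc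
      rw [pow_succ] at hc
      apply h
      rw [hη.2.2.2, hη.2.2.2, sub_self]
      · rw [abs_of_nonneg (by positivity), mul_assoc, le_inv_mul_iff₀ hpos]; linarith
      · rw [abs_of_nonneg (by positivity), le_inv_mul_iff₀ hpos]; linarith

lemma norm_prj_le {m k : ℕ} {ξ : EE (m+1)} (h : ξ ∈ lizorkinShell (m := m) k) :
    ‖prj m ξ‖ ≤ 2^m * 2^k := by
  have h1 := (iSup_abs_le_iff ξ _).1 (shell_le h)
  refine abs_le_of_sq_le_sq' ?_ (by positivity) |>.2
  rw [EuclideanSpace.norm_sq_eq]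
  calc ∑ i, ‖prj m ξ i‖^2 ≤ ∑ i : Fin m, ((2:ℝ)^k)^2 := by
        gcongr with i
        rw [prj_apply, Real.norm_eq_abs]; exact h1 _
    _ = (m:ℝ) * (2^k)^2 := by simp
    _ ≤ (2^m)^2 * (2^k)^2 := by
        gcongr
        have h3 : (m:ℝ) ≤ 2^m := by exact_mod_cast (Nat.lt_two_pow_self (n := m)).le
        have h4 : (1:ℝ) ≤ 2^m := one_le_pow₀ (by norm_num)
        nlinarith
    _ = _ := by ring

lemma j_le {η : ℝ → ℝ} (hη : IsBump η) {m j k : ℕ} {ξ : EE (m+1)}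
    (h : ξ ∈ lizorkinShell (m := m) k) (hl : littlewood η j (prj m ξ) ≠ 0) : j ≤ m + k := by
  rcases (littlewood_ne_zero hη hl).1 with h0 | h0
  · omega
  · have h1 := norm_prj_le h
    have h2 : (2:ℝ)^j < 2^(m+k+1) := by
      rw [pow_succ, pow_add]; linarith
    have := (pow_lt_pow_iff_right₀ (by norm_num : (1:ℝ) < 2)).1 h2
    omega

lemma k_le {η : ℝ → ℝ} (hη : IsBump η) {m j k : ℕ} {ξ : EE (m+1)}
    (h : ξ ∈ lizorkinShell (m := m) k \ lizorkinAxis (m := m) k)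
    (hl : littlewood η j (prj m ξ) ≠ 0) : k ≤ j + 1 := by
  obtain ⟨hs, ha⟩ := h
  have h2 := (littlewood_ne_zero hη hl).2
  by_cases hk : k = 0
  · omega
  · simp only [lizorkinAxis, hk, if_false, Set.mem_ofPred_eq, hs, true_and, not_forall, not_le] at ha
    obtain ⟨i, hi⟩ := ha
    have h3 : |ξ i.castSucc| ≤ ‖prj m ξ‖ := by
      have := PiLp.norm_apply_le (prj m ξ) i
      rwa [prj_apply, Real.norm_eq_abs] at this
    have := (pow_lt_pow_iff_right₀ (by norm_num : (1:ℝ) < 2)).1 (hi.trans (h3.trans_lt h2))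
    omega

lemma TT_zero {m : ℕ} {p : ℝ≥0∞} {φ : EE m → ℂ} {h : EE (m+1) → ℂ}
    (hz : ∀ ξ, φ (prj m ξ) * h ξ = 0) : eLpNorm (TT φ h) p volume = 0 := by
  have : TT φ h = 0 := by
    funext x; simp [TT, hz]
  rw [this]; simp

lemma cutF_ne {m : ℕ} {E : Set (EE (m+1))} {f : EE (m+1) → ℂ} {ξ : EE (m+1)}
    (h : cutF E f ξ ≠ 0) : ξ ∈ E := by
  by_contra hc; exact h (by simp [cutF, hc])

/-- For `n = m+1 ≥ 2`, `1 < p < ∞`, `0 < q ≤ ∞` and `r = min(q,1)`,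
`‖Tr f‖_{B^0_{p,q}(ℝ^{n-1})} ≤ C (Σ_k [(1+k) 2^{kr/p} a_k(f)^r + 2^{kr/p} b_k(f)^r])^{1/r}`. -/
theorem trace_besov_lizorkin_limit
    (m : ℕ) (hm : 1 ≤ m) (η : ℝ → ℝ) (hη : IsBump η)
    (p q : ℝ≥0∞) (hp : 1 < p) (hp' : p ≠ ∞) (hq : 0 < q) (r : ℝ)
    (hr : r = (min q 1).toReal) :
    ∃ C : ℝ≥0∞, 0 < C ∧ C ≠ ∞ ∧
      ∀ f : SchwartzMap (EuclideanSpace ℝ (Fin (m+1))) ℂ,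
        besovNorm η 0 p q (traceFn (⇑f)) ≤
          C * (∑' k : ℕ,
              ((1 + (k:ℝ≥0∞)) * ENNReal.ofReal ((2:ℝ) ^ ((k:ℝ) * r / p.toReal)) *
                  aCoef p k (⇑f) ^ r +
                ENNReal.ofReal ((2:ℝ) ^ ((k:ℝ) * r / p.toReal)) *
                  bCoef p k (⇑f) ^ r)) ^ (1/r) := by
  have hp0 : p ≠ 0 := (zero_lt_one.trans hp).ne'
  have hP1 : 1 < p.toReal := by
    rw [← ENNReal.toReal_one]; exact (ENNReal.toReal_lt_toReal (by simp) hp').2 hp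
  have hr0 : 0 < r := by
    rw [hr]; exact ENNReal.toReal_pos (by simp [hq.ne']) (by simp)
  have hr1 : r ≤ 1 := by
    rw [hr, ← ENNReal.toReal_one]; exact ENNReal.toReal_mono (by simp) (min_le_right _ _)
  have hP := Real.HolderConjugate.conjExponent hP1
  obtain ⟨C1, hC1, hφ⟩ := littlewood_kernel hη m
  obtain ⟨C2, hC2, hψ⟩ := psi_kernel hη hP
  choose φ hφ1 hφ2 using hφ
  choose ψ hψ1 hψ2 using hψ
  set B := C1 * C2 with hB
  set M : ℝ≥0∞ := (m : ℝ≥0∞) + 2 with hM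
  have hBt : B ≠ ⊤ := ENNReal.mul_ne_top hC1 hC2
  have hMt : M ≠ ⊤ := by simp [hM]
  refine ⟨(M * B ^ r) ^ (1/r) + 1, by simp, ?_, fun f => ?_⟩
  · refine ENNReal.add_ne_top.2 ⟨ENNReal.rpow_ne_top_of_nonneg (by positivity)
      (ENNReal.mul_ne_top hMt (ENNReal.rpow_ne_top_of_nonneg hr0.le hBt)), by simp⟩
  set w : ℕ → ℝ≥0∞ := fun k => ENNReal.ofReal ((2:ℝ) ^ ((k:ℝ) / p.toReal)) with hw
  have hwr : ∀ k, w k ^ r = ENNReal.ofReal ((2:ℝ) ^ ((k:ℝ) * r / p.toReal)) := by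
    intro k
    rw [hw]; simp only
    rw [ENNReal.ofReal_rpow_of_nonneg (by positivity) hr0.le, ← Real.rpow_mul (by norm_num)]
    congr 2; ring
  simp only [← hwr]
  set A : ℕ → Set (EE (m+1)) := fun k => lizorkinAxis (m := m) k
  set A' : ℕ → Set (EE (m+1)) := fun k => lizorkinShell (m := m) k \ lizorkinAxis (m := m) k
  have hAm : ∀ k, MeasurableSet (A k) := axis_measurable m
  have hAm' : ∀ k, MeasurableSet (A' k) := fun k => (shell_measurable m k).diff (hAm k)
  have gen : ∀ (E : Set (EE (m+1))) (k j : ℕ), MeasurableSet E → E ⊆ lizorkinShell (m := m) k →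
      eLpNorm (TT (φ j) (cutF E f)) p volume ≤ B * (w k * eLpNorm (cutBox E f) p volume) := by
    intro E k j hE hEs
    have := TT_bound hp hp' hP (φ j) (ψ k) (cutF_integrable hE f) (fun ξ hξ => by
      apply hψ1
      exact (iSup_abs_le_iff ξ _).1 (shell_le (hEs (cutF_ne hξ))) _)
    refine this.trans ?_
    calc _ ≤ C1 * (C2 * w k) * eLpNorm (cutBox E f) p volume := by
          gcongr
          · exact hφ2 j
          · exact hψ2 k
          · exact le_rfl
      _ = _ := by rw [hB]; ring
  have ba : ∀ j k, eLpNorm (TT (φ j) (cutF (A k) f)) p volume ^ r ≤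
      if j ∈ Finset.range (m + k + 1) then B ^ r * (w k ^ r * aCoef p k f ^ r) else 0 := by
    intro j k
    split_ifs with h
    · rw [← ENNReal.mul_rpow_of_nonneg _ _ hr0.le, ← ENNReal.mul_rpow_of_nonneg _ _ hr0.le]
      exact ENNReal.rpow_le_rpow (gen _ k j (hAm k) (axis_subset m k)) hr0.le
    · rw [TT_zero, ENNReal.zero_rpow_of_pos hr0]
      intro ξ
      by_contra hc
      obtain ⟨h1, h2⟩ := mul_ne_zero_iff.1 hc
      rw [hφ1] at h1
      have := j_le hη (axis_subset m k (cutF_ne h2)) (by exact_mod_cast h1)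
      simp at h; omega
  have bb : ∀ j k, eLpNorm (TT (φ j) (cutF (A' k) f)) p volume ^ r ≤
      if j ∈ Finset.Ico (k - 1) (m + k + 1) then B ^ r * (w k ^ r * bCoef p k f ^ r) else 0 := by
    intro j k
    split_ifs with h
    · rw [← ENNReal.mul_rpow_of_nonneg _ _ hr0.le, ← ENNReal.mul_rpow_of_nonneg _ _ hr0.le]
      exact ENNReal.rpow_le_rpow (gen _ k j (hAm' k) Set.sdiff_subset) hr0.le
    · rw [TT_zero, ENNReal.zero_rpow_of_pos hr0]
      intro ξ
      by_contra hc
      obtain ⟨h1, h2⟩ := mul_ne_zero_iff.1 hc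
      rw [hφ1] at h1
      have h3 : ξ ∈ A' k := cutF_ne h2
      have := j_le hη h3.1 (by exact_mod_cast h1)
      have := k_le hη h3 (by exact_mod_cast h1)
      simp at h; omega
  have sumite : ∀ (s : Finset ℕ) (c : ℝ≥0∞), ∑' j, (if j ∈ s then c else 0) = (s.card : ℝ≥0∞) * c := by
    intro s c
    rw [tsum_eq_sum (s := s) (fun j hj => by simp [hj]),
      Finset.sum_congr rfl (fun j hj => if_pos hj)]
    simp
  have hD : ∀ j, eLpNorm (dyadicBox η j (traceFn f)) p volume ≤
      ∑' k, (eLpNorm (TT (φ j) (cutF (A k) f)) p volume +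
        eLpNorm (TT (φ j) (cutF (A' k) f)) p volume) := by
    intro j
    have e : dyadicBox η j (traceFn f) = TT (φ j) (𝓕 (f : EE (m+1) → ℂ)) := by
      funext x
      rw [← claimB]
      simp only [dyadicBox, hφ1]
    rw [e]
    exact minkowski hp.le (fun k => (TT_continuous (φ j) (cutF_integrable (hAm k) f)).1)
      (fun k => (TT_continuous (φ j) (cutF_integrable (hAm' k) f)).1) (TT_hasSum (φ j) f)
  set S := ∑' k : ℕ, ((1 + (k:ℝ≥0∞)) * w k ^ r * aCoef p k f ^ r + w k ^ r * bCoef p k f ^ r)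
  have main : ∑' j, eLpNorm (dyadicBox η j (traceFn f)) p volume ^ r ≤ (M * B ^ r) * S := by
    calc _ ≤ ∑' j, ∑' k, (eLpNorm (TT (φ j) (cutF (A k) f)) p volume ^ r +
            eLpNorm (TT (φ j) (cutF (A' k) f)) p volume ^ r) := by
          refine ENNReal.tsum_le_tsum fun j => ?_
          refine (ENNReal.rpow_le_rpow (hD j) hr0.le).trans ((rpow_tsum_le hr0 hr1).trans ?_)
          exact ENNReal.tsum_le_tsum fun k => ENNReal.rpow_add_le_add_rpow _ _ hr0.le hr1
      _ = ∑' k, ∑' j, (eLpNorm (TT (φ j) (cutF (A k) f)) p volume ^ r +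
            eLpNorm (TT (φ j) (cutF (A' k) f)) p volume ^ r) := ENNReal.tsum_comm
      _ ≤ ∑' k : ℕ, ((M * B ^ r) * ((1 + (k:ℝ≥0∞)) * w k ^ r * aCoef p k f ^ r +
            w k ^ r * bCoef p k f ^ r)) := by
          refine ENNReal.tsum_le_tsum fun k => ?_
          rw [ENNReal.tsum_add, mul_add]
          refine add_le_add ?_ ?_
          · refine (ENNReal.tsum_le_tsum fun j => ba j k).trans ?_
            rw [sumite]
            calc _ ≤ (M * (1 + (k:ℝ≥0∞))) * (B ^ r * (w k ^ r * aCoef p k f ^ r)) := by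
                  gcongr
                  rw [hM, Finset.card_range]
                  norm_cast
                  nlinarith [Nat.zero_le (m * k)]
              _ = _ := by ring
          · refine (ENNReal.tsum_le_tsum fun j => bb j k).trans ?_
            rw [sumite]
            calc _ ≤ M * (B ^ r * (w k ^ r * bCoef p k f ^ r)) := by
                  gcongr
                  rw [hM, Nat.card_Ico]
                  norm_cast
                  omega
              _ = _ := by ring
      _ = _ := ENNReal.tsum_mul_left
  have hbes : besovNorm η 0 p q (traceFn f) ≤
      (∑' j, eLpNorm (dyadicBox η j (traceFn f)) p volume ^ r) ^ (1/r) := by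
    unfold besovNorm
    refine (lqSum_le hq hr _).trans_eq ?_
    simp
  calc _ ≤ _ := hbes
    _ ≤ ((M * B ^ r) * S) ^ (1/r) := ENNReal.rpow_le_rpow main (by positivity)
    _ = (M * B ^ r) ^ (1/r) * S ^ (1/r) := ENNReal.mul_rpow_of_nonneg _ _ (by positivity)
    _ ≤ _ := by gcongr; exact le_self_add
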